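/- The number of edges of the tilde-Fibonacci cube satisfies |E(F̃_1)| = 1, |E(F̃_2)| = 3, and for all n ≥ 3, |E(F̃_n)| = |E(F̃_{n-1})| + |E(F̃_{n-2})| + f_{n+1}. -/

import Mathlib

/-- One tilde edit step: a replacement (flip one symbol) or a swap of two
adjacent distinct symbols. -/
inductive TStep : List Bool → List Bool → Prop
  | repl (x y : List Bool) (a : Bool) : TStep (x ++ a :: y) (x ++ (!a) :: y)
  | swap (x y : List Bool) (a : Bool) : TStep (x ++ a :: (!a) :: y) (x ++ (!a) :: a :: y)

/-- `reach step h u v` : `v` can be obtained from `u` by a chain of `h` steps. -/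
def reach (step : List Bool → List Bool → Prop) : ℕ → List Bool → List Bool → Prop
  | 0 => Eq
  | h + 1 => fun u v => ∃ w, step u w ∧ reach step h w v

/-- The tilde-distance: the minimum number of replacements and swaps needed to
transform `u` into `v`. -/
noncomputable def tildeDist (u v : List Bool) : ℕ := sInf {h | reach TStep h u v}

theorem TStep.symm {u v : List Bool} (h : TStep u v) : TStep v u := by
  cases h with
  | repl x y a => simpa using TStep.repl x y (!a)
  | swap x y a => simpa using TStep.swap x y (!a)

theorem reach_snoc {step : List Bool → List Bool → Prop} :
    ∀ {h : ℕ} {u v w : List Bool}, reach step h u v → step v w → reach step (h + 1) u w := by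
  intro h
  induction h with
  | zero => intro u v w r s; exact ⟨w, r ▸ s, rfl⟩
  | succ h ih => intro u v w r s; obtain ⟨z, su, rz⟩ := r; exact ⟨z, su, ih rz s⟩

theorem reach_symm : ∀ {h : ℕ} {u v : List Bool}, reach TStep h u v → reach TStep h v u := by
  intro h
  induction h with
  | zero => intro u v r; exact r.symm
  | succ h ih => intro u v r; obtain ⟨w, s, rw⟩ := r; exact reach_snoc (ih rw) s.symm

theorem tildeDist_comm (u v : List Bool) : tildeDist u v = tildeDist v u := by
  unfold tildeDist
  congr 1
  ext h
  exact ⟨fun r => reach_symm r, fun r => reach_symm r⟩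

theorem tildeDist_self (u : List Bool) : tildeDist u u = 0 :=
  Nat.sInf_eq_zero.mpr (Or.inl rfl)

/-- The Hamming distance: the number of positions at which `u` and `v` differ. -/
def hammDist (u v : List Bool) : ℕ := ((u.zip v).filter fun p => p.1 != p.2).length

theorem hammDist_comm : ∀ u v : List Bool, hammDist u v = hammDist v u
  | [], [] => rfl
  | [], _ :: _ => rfl
  | _ :: _, [] => rfl
  | a :: u, b :: v => by
    cases a <;> cases b <;>
      simp [hammDist, List.filter_cons, hammDist_comm u v, hammDist] <;>
      simpa [hammDist] using hammDist_comm u v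

theorem hammDist_self : ∀ u : List Bool, hammDist u u = 0
  | [] => rfl
  | a :: u => by simpa [hammDist, List.filter_cons] using hammDist_self u

/-- Binary words of length `n`. -/
abbrev Word (n : ℕ) := {w : List Bool // w.length = n}

/-- The `n`-tilde-hypercube: vertices are the binary words of length `n`, and
two vertices are adjacent iff their tilde-distance is `1`. -/
noncomputable def tildeCube (n : ℕ) : SimpleGraph (Word n) where
  Adj u v := tildeDist u.val v.val = 1
  symm := ⟨by intro u v h; rwa [tildeDist_comm]⟩
  loopless := ⟨by intro u h; rw [tildeDist_self] at h; exact one_ne_zero h.symm⟩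

/-- The `n`-hypercube: vertices are the binary words of length `n`, and
two vertices are adjacent iff their Hamming distance is `1`. -/
def hamCube (n : ℕ) : SimpleGraph (Word n) where
  Adj u v := hammDist u.val v.val = 1
  symm := ⟨by intro u v h; rwa [hammDist_comm]⟩
  loopless := ⟨by intro u h; rw [hammDist_self] at h; exact one_ne_zero h.symm⟩

/-- `f` is tilde-isometric. -/
def TildeIsometric (f : List Bool) : Prop :=
  ∀ n : ℕ, f.length ≤ n → ∀ u v : List Bool, u.length = n → v.length = n →
    ¬ f <:+: u → ¬ f <:+: v →
    ∃ w : ℕ → List Bool, w 0 = u ∧ w (tildeDist u v) = v ∧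
      (∀ k < tildeDist u v, tildeDist (w k) (w (k + 1)) = 1) ∧
      (∀ k ≤ tildeDist u v, ¬ f <:+: w k)

/-- `f` is Ham-isometric. -/
def HamIsometric (f : List Bool) : Prop :=
  ∀ u v : List Bool, u.length = v.length →
    ¬ f <:+: u → ¬ f <:+: v →
    ∃ w : ℕ → List Bool, w 0 = u ∧ w (hammDist u v) = v ∧
      (∀ k ≤ hammDist u v, (w k).length = u.length) ∧
      (∀ k < hammDist u v, hammDist (w k) (w (k + 1)) = 1) ∧
      (∀ k ≤ hammDist u v, ¬ f <:+: w k)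
/-- The set of words of length `n` avoiding the factor `11`. -/
def fibFree (n : ℕ) : Set (Word n) := {w | ¬ [true, true] <:+: w.val}

/-- The `n`-tilde-Fibonacci cube: the subgraph of the tilde-hypercube induced by
the words avoiding the factor `11`. -/
noncomputable def tildeFibCube (n : ℕ) : SimpleGraph (fibFree n) :=
  (tildeCube n).induce (fibFree n)

/-- The `n`-Fibonacci cube: the subgraph of the hypercube induced by
the words avoiding the factor `11`. -/
def fibCube (n : ℕ) : SimpleGraph (fibFree n) :=
  (hamCube n).induce (fibFree n)

def UpS : List Bool → List Bool → Prop
  | a :: u, b :: v => (a = b ∧ UpS u v) ∨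
      (a = false ∧ b = true ∧ (u = v ∨ ∃ y, u = true :: y ∧ v = false :: y))
  | _, _ => False

def FreeW : List Bool → Prop
  | [] => True
  | false :: w => FreeW w
  | [true] => True
  | true :: false :: w => FreeW w
  | true :: true :: _ => False

theorem freeW_iff : ∀ w : List Bool, (¬ [true, true] <:+: w) ↔ FreeW w
  | [] => by simp [FreeW]
  | false :: w => by
    rw [List.infix_cons_iff, FreeW, ← freeW_iff w]; simp
  | [true] => by simp [FreeW, List.infix_cons_iff]
  | true :: false :: w => by
    rw [List.infix_cons_iff, List.infix_cons_iff, FreeW, ← freeW_iff w]; simp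
  | true :: true :: w => by
    rw [List.infix_cons_iff]; simp [FreeW]

theorem upS_asymm : ∀ u v : List Bool, UpS u v → ¬ UpS v u
  | [], _ => by simp [UpS]
  | _ :: _, [] => by simp [UpS]
  | a :: u, b :: v => by
    have := upS_asymm u v
    simp only [UpS]
    grind

theorem upS_irrefl (u : List Bool) : ¬ UpS u u := fun h => upS_asymm u u h h

theorem tstep_cons {u v : List Bool} (a : Bool) (h : TStep u v) : TStep (a :: u) (a :: v) := by
  cases h with
  | repl x y b => exact TStep.repl (a :: x) y b
  | swap x y b => exact TStep.swap (a :: x) y b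

theorem tstep_of_upS : ∀ u v : List Bool, UpS u v → TStep u v
  | [], _ => by simp [UpS]
  | _ :: _, [] => by simp [UpS]
  | a :: u, b :: v => by
    simp only [UpS]
    rintro (⟨rfl, h⟩ | ⟨rfl, rfl, rfl | ⟨y, rfl, rfl⟩⟩)
    · exact tstep_cons a (tstep_of_upS u v h)
    · exact TStep.repl [] u false
    · exact TStep.swap [] y false

theorem upS_append {u v : List Bool} (x : List Bool) (h : UpS u v) : UpS (x ++ u) (x ++ v) := by
  induction x with
  | nil => exact h
  | cons a x ih => exact Or.inl ⟨rfl, ih⟩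

theorem tstep_iff (u v : List Bool) : TStep u v ↔ UpS u v ∨ UpS v u := by
  constructor
  · intro h
    cases h with
    | repl x y a =>
      cases a
      · exact Or.inl (upS_append x (Or.inr ⟨rfl, rfl, Or.inl rfl⟩))
      · exact Or.inr (upS_append x (Or.inr ⟨rfl, rfl, Or.inl rfl⟩))
    | swap x y a =>
      cases a
      · exact Or.inl (upS_append x (Or.inr ⟨rfl, rfl, Or.inr ⟨y, rfl, rfl⟩⟩))
      · exact Or.inr (upS_append x (Or.inr ⟨rfl, rfl, Or.inr ⟨y, rfl, rfl⟩⟩))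
  · rintro (h | h)
    · exact tstep_of_upS _ _ h
    · exact (tstep_of_upS _ _ h).symm

theorem reach_one (u v : List Bool) : reach TStep 1 u v ↔ TStep u v := by
  simp [reach]

theorem tildeDist_one (u v : List Bool) : tildeDist u v = 1 ↔ UpS u v ∨ UpS v u := by
  rw [← tstep_iff, ← reach_one]
  constructor
  · intro h
    have hne : {h | reach TStep h u v}.Nonempty := by
      by_contra hc
      rw [Set.not_nonempty_iff_eq_empty] at hc
      simp [tildeDist, hc] at h
    have := Nat.sInf_mem hne
    unfold tildeDist at h
    rw [h] at this
    exact this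
  · intro h
    have h1 : tildeDist u v ≤ 1 := Nat.sInf_le h
    have h0 : tildeDist u v ≠ 0 := by
      intro h0
      have hm : reach TStep (tildeDist u v) u v := Nat.sInf_mem (s := {h | reach TStep h u v}) ⟨1, h⟩
      rw [h0] at hm
      have hm' : u = v := hm
      subst hm'
      rw [reach_one, tstep_iff] at h
      exact upS_irrefl u (by tauto)
    omega

def WS (n : ℕ) : Set (List Bool) := {w | w.length = n ∧ FreeW w}

def ES (n : ℕ) : Set (List Bool × List Bool) :=
  {p | p.1 ∈ WS n ∧ p.2 ∈ WS n ∧ UpS p.1 p.2}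

theorem WS_finite (n : ℕ) : (WS n).Finite :=
  (List.finite_length_eq Bool n).subset fun _ h => h.1

theorem ES_finite (n : ℕ) : (ES n).Finite :=
  ((WS_finite n).prod (WS_finite n)).subset fun _ h => ⟨h.1, h.2.1⟩

theorem card_edge (n : ℕ) : Nat.card (tildeFibCube n).edgeSet = (ES n).ncard := by
  rw [← Nat.card_coe_set_eq]
  symm
  have key (u v : fibFree n) : s(u, v) ∈ (tildeFibCube n).edgeSet ↔
      UpS u.1.1 v.1.1 ∨ UpS v.1.1 u.1.1 := by
    rw [SimpleGraph.mem_edgeSet, ← tildeDist_one]; rfl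
  let mk (w : List Bool) (h : w ∈ WS n) : fibFree n := ⟨⟨w, h.1⟩, (freeW_iff w).2 h.2⟩
  refine Nat.card_congr (Equiv.ofBijective
    (fun p : ES n => (⟨s(mk p.1.1 p.2.1, mk p.1.2 p.2.2.1), (key _ _).2 (Or.inl p.2.2.2)⟩ :
      (tildeFibCube n).edgeSet)) ⟨?_, ?_⟩)
  · rintro ⟨⟨a, b⟩, ha, hb, hab⟩ ⟨⟨c, d⟩, hc, hd, hcd⟩ h
    simp only [Subtype.mk.injEq, Sym2.eq_iff, mk] at h
    have inj (x y : fibFree n) (e : x = y) : x.1.1 = y.1.1 :=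
      congrArg (fun z : fibFree n => z.1.1) e
    rcases h with ⟨h1, h2⟩ | ⟨h1, h2⟩ <;>
      replace h1 := inj _ _ h1 <;> replace h2 := inj _ _ h2 <;>
      dsimp only at h1 h2 <;> subst h1 <;> subst h2
    · rfl
    · exact absurd hcd (upS_asymm _ _ hab)
  · rintro ⟨e, he⟩
    induction e using Sym2.ind with
    | _ u v =>
      have hu : u.1.1 ∈ WS n := ⟨u.1.2, (freeW_iff _).1 u.2⟩
      have hv : v.1.1 ∈ WS n := ⟨v.1.2, (freeW_iff _).1 v.2⟩
      rcases (key u v).1 he with h | h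
      · exact ⟨⟨(u.1.1, v.1.1), hu, hv, h⟩, rfl⟩
      · exact ⟨⟨(v.1.1, u.1.1), hv, hu, h⟩, Subtype.ext Sym2.eq_swap⟩

theorem WS_zero : WS 0 = {[]} := by
  ext w; cases w <;> simp [WS, FreeW]

theorem WS_one : WS 1 = {[false], [true]} := by
  ext w
  rcases w with _ | ⟨_ | _, _ | ⟨b, w⟩⟩ <;> simp [WS, FreeW]

theorem WS_succ_succ (n : ℕ) : WS (n + 2) =
    (fun w => false :: w) '' WS (n + 1) ∪ (fun w => true :: false :: w) '' WS n := by
  ext w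
  rcases w with _ | ⟨_ | _, _ | ⟨_ | _, w⟩⟩ <;> simp [WS, FreeW]

theorem WS_card : ∀ n, (WS n).ncard = Nat.fib (n + 2)
  | 0 => by simp [WS_zero]
  | 1 => by rw [WS_one, Set.ncard_pair (by simp)]; rfl
  | n + 2 => by
    rw [WS_succ_succ, Set.ncard_union_eq _ ((WS_finite _).image _) ((WS_finite _).image _),
      Set.ncard_image_of_injective _ (fun a b h => by simpa using h),
      Set.ncard_image_of_injective _ (fun a b h => by simpa using h),
      WS_card n, WS_card (n + 1), Nat.fib_add_two (n := n + 2)]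
    · ring
    · rw [Set.disjoint_left]
      rintro _ ⟨a, _, rfl⟩ ⟨b, _, h⟩
      simp at h

/-- words that may follow a `true` -/
def VS (n : ℕ) : Set (List Bool) := {w | w.length = n ∧ FreeW (true :: w)}

theorem VS_card : ∀ n, (VS n).ncard = Nat.fib (n + 1)
  | 0 => by
    have : VS 0 = {[]} := by ext w; cases w <;> simp [VS, FreeW]
    simp [this]
  | n + 1 => by
    have : VS (n + 1) = (fun w => false :: w) '' WS n := by
      ext w
      rcases w with _ | ⟨_ | _, w⟩ <;> simp [VS, WS, FreeW]
    rw [this, Set.ncard_image_of_injective _ (fun a b h => by simpa using h), WS_card]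

theorem freeW_of_cons (a : Bool) (w : List Bool) (h : FreeW (a :: w)) : FreeW w := by
  rcases a with _ | _ <;> rcases w with _ | ⟨_ | _, w⟩ <;> simp_all [FreeW]

theorem VS_finite (n : ℕ) : (VS n).Finite :=
  (List.finite_length_eq Bool n).subset fun _ h => h.1

set_option maxHeartbeats 4000000 in
theorem ES_succ_succ (n : ℕ) : ES (n + 2) =
    (((fun p : List Bool × List Bool => (false :: p.1, false :: p.2)) '' ES (n + 1) ∪
    (fun p : List Bool × List Bool => (true :: false :: p.1, true :: false :: p.2)) '' ES n) ∪
    (fun w => (false :: false :: w, true :: false :: w)) '' WS n) ∪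
    (fun w => (false :: true :: w, true :: false :: w)) '' VS n := by
  ext ⟨u, v⟩
  rcases u with _ | ⟨_ | _, _ | ⟨_ | _, u⟩⟩ <;> rcases v with _ | ⟨_ | _, _ | ⟨_ | _, v⟩⟩ <;>
    simp [ES, WS, VS, FreeW, UpS] <;> grind [freeW_of_cons]

theorem ES_card (n : ℕ) :
    (ES (n + 2)).ncard = (ES (n + 1)).ncard + (ES n).ncard + Nat.fib (n + 3) := by
  have h1 := (ES_finite (n + 1)).image
    (fun p : List Bool × List Bool => (false :: p.1, false :: p.2))
  have h2 := (ES_finite n).image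
    (fun p : List Bool × List Bool => (true :: false :: p.1, true :: false :: p.2))
  have h3 := (WS_finite n).image (fun w => (false :: false :: w, true :: false :: w))
  have h4 := (VS_finite n).image (fun w => (false :: true :: w, true :: false :: w))
  rw [ES_succ_succ, Set.ncard_union_eq _ ((h1.union h2).union h3) h4,
    Set.ncard_union_eq _ (h1.union h2) h3, Set.ncard_union_eq _ h1 h2,
    Set.ncard_image_of_injective, Set.ncard_image_of_injective,
    Set.ncard_image_of_injective, Set.ncard_image_of_injective, WS_card, VS_card,
    Nat.fib_add_two (n := n + 1)]
  · ring
  · intro a b h; simpa using h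
  · intro a b h; simpa using h
  · intro a b h; simpa [Prod.ext_iff] using h
  · intro a b h; simpa [Prod.ext_iff] using h
  · rw [Set.disjoint_left]
    rintro _ ⟨a, _, rfl⟩ ⟨b, _, h⟩
    simp at h
  · rw [Set.disjoint_left]
    rintro _ (⟨a, _, rfl⟩ | ⟨a, _, rfl⟩) ⟨b, _, h⟩ <;> simp at h
  · rw [Set.disjoint_left]
    rintro _ ((⟨a, _, rfl⟩ | ⟨a, _, rfl⟩) | ⟨a, _, rfl⟩) ⟨b, _, h⟩ <;> simp at h

theorem ES_zero : (ES 0).ncard = 0 := by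
  have : ES 0 = ∅ := by
    ext ⟨u, v⟩; simp [ES, WS_zero]; rintro rfl rfl; simp [UpS]
  simp [this]

theorem ES_one : (ES 1).ncard = 1 := by
  have : ES 1 = {([false], [true])} := by
    ext ⟨u, v⟩
    simp only [ES, WS_one, Set.mem_setOf_eq, Set.mem_insert_iff, Set.mem_singleton_iff,
      Prod.mk.injEq]
    constructor
    · rintro ⟨rfl | rfl, rfl | rfl, h⟩ <;> simp [UpS] at h ⊢
    · rintro ⟨rfl, rfl⟩; simp [UpS]
  simp [this]

/-- Recurrence for the number of edges of the tilde-Fibonacci cube. -/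
theorem tildeFibCube_edge_recurrence :
    Nat.card (tildeFibCube 1).edgeSet = 1 ∧
    Nat.card (tildeFibCube 2).edgeSet = 3 ∧
    ∀ n : ℕ, 3 ≤ n →
      Nat.card (tildeFibCube n).edgeSet =
        Nat.card (tildeFibCube (n - 1)).edgeSet + Nat.card (tildeFibCube (n - 2)).edgeSet +
          Nat.fib (n + 1) := by
  simp only [card_edge]
  refine ⟨ES_one, ?_, ?_⟩
  · rw [ES_card 0, ES_one, ES_zero]; rfl
  · intro n hn
    obtain ⟨m, rfl⟩ : ∃ m, n = m + 2 := ⟨n - 2, by omega⟩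
    exact ES_card m
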